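/- arXiv:cs/0202022 — 2 statements merged into one kernel-verified Lean document; each statement's English description precedes it below -/
import Mathlib

section
/- Loop property of rational closure: let K_0, …, K_{n−1} be knowledge bases, each possessing a rational closure, such that for every i (addition modulo n) K_{i+1} ⊆ rational closure of K_i. Then for all i, j, the rational closure of K_i equals the rational closure of K_j. In particular (cumulativity): if X ⊆ Y ⊆ rational closure of X, and both X and Y have rational closures, then the rational closures of X and Y are equal. -/
/-- Propositional formulas over a set `V` of propositional variables. -/
inductive Fm (V : Type) : Type
  | var : V → Fm V
  | fls : Fm V
  | tru : Fm V
  | neg : Fm V → Fm V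
  | conj : Fm V → Fm V → Fm V
  | disj : Fm V → Fm V → Fm V
  | impl : Fm V → Fm V → Fm V
  | iff : Fm V → Fm V → Fm V

variable {V : Type}

/-- Truth value of a formula in a world (truth assignment). -/
def Fm.eval (w : V → Bool) : Fm V → Bool
  | .var v => w v
  | .fls => false
  | .tru => true
  | .neg a => !(a.eval w)
  | .conj a b => a.eval w && b.eval w
  | .disj a b => a.eval w || b.eval w
  | .impl a b => !(a.eval w) || b.eval w
  | .iff a b => a.eval w == b.eval w

/-- A formula is valid iff it is satisfied by every world. -/
def Valid (a : Fm V) : Prop := ∀ w : V → Bool, a.eval w = true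

/-- A conditional "relation": a set of conditional assertions (pairs of formulas). -/
abbrev CRel (V : Type) := Set (Fm V × Fm V)

/-- Preferential consequence relation: Reflexivity, Left Logical Equivalence,
Right Weakening, And, Or, Cautious Monotonicity. -/
def IsPreferential (K : CRel V) : Prop :=
  (∀ a, (a, a) ∈ K) ∧
  (∀ a b c, Valid (a.iff b) → (a, c) ∈ K → (b, c) ∈ K) ∧
  (∀ a b c, Valid (a.impl b) → (c, a) ∈ K → (c, b) ∈ K) ∧
  (∀ a b c, (a, b) ∈ K → (a, c) ∈ K → (a, b.conj c) ∈ K) ∧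
  (∀ a b c, (a, c) ∈ K → (b, c) ∈ K → (a.disj b, c) ∈ K) ∧
  (∀ a b c, (a, b) ∈ K → (a, c) ∈ K → (a.conj b, c) ∈ K)

/-- Rational Monotonicity: if α∧β |~/ γ and α |~/ ¬β then α |~/ γ. -/
def RationalMonotonicity (K : CRel V) : Prop :=
  ∀ a b c, (a.conj b, c) ∉ K → (a, b.neg) ∉ K → (a, c) ∉ K

/-- A rational consequence relation is a preferential one satisfying Rational
Monotonicity. -/
def IsRational (K : CRel V) : Prop := IsPreferential K ∧ RationalMonotonicity K

/-- Disjunctive Rationality: if α |~/ γ and β |~/ γ then α∨β |~/ γ. -/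
def DisjunctiveRationality (K : CRel V) : Prop :=
  ∀ a b c, (a, c) ∉ K → (b, c) ∉ K → (a.disj b, c) ∉ K

/-- Negation Rationality: if α∧γ |~/ β and α∧¬γ |~/ β then α |~/ β. -/
def NegationRationality (K : CRel V) : Prop :=
  ∀ a b c, (a.conj c, b) ∉ K → (a.conj c.neg, b) ∉ K → (a, b) ∉ K

/-- `s` is minimal in `A` with respect to the strict order `lt`. -/
def MinIn {S : Type} (lt : S → S → Prop) (A : Set S) (s : S) : Prop :=
  s ∈ A ∧ ∀ t ∈ A, ¬ lt t s

/-- A preferential model: states, labeling by worlds, a strict partial order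
satisfying the smoothness condition for each formula. -/
structure PrefModel (V : Type) where
  S : Type
  l : S → V → Bool
  lt : S → S → Prop
  irrefl : ∀ s, ¬ lt s s
  trans : ∀ s t u, lt s t → lt t u → lt s u
  smooth : ∀ (a : Fm V) (s : S), a.eval (l s) = true →
    MinIn lt {t | a.eval (l t) = true} s ∨
    ∃ t, MinIn lt {t | a.eval (l t) = true} t ∧ lt t s

/-- The model `W` satisfies α |~ β iff every state minimal in α̂ satisfies β. -/
def PrefModel.Sat (W : PrefModel V) (a b : Fm V) : Prop :=
  ∀ s, MinIn W.lt {t | a.eval (W.l t) = true} s → b.eval (W.l s) = true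

/-- The consequence relation defined by a preferential model. -/
def PrefModel.Rel (W : PrefModel V) : CRel V := {p | W.Sat p.1 p.2}

/-- `W` is a model of the knowledge base `K`. -/
def PrefModel.Models (W : PrefModel V) (K : CRel V) : Prop := ∀ p ∈ K, W.Sat p.1 p.2

/-- Preferential entailment: `A` is satisfied by every preferential model of `K`. -/
def Entails (K : CRel V) (A : Fm V × Fm V) : Prop :=
  ∀ W : PrefModel V, W.Models K → W.Sat A.1 A.2

/-- The preferential closure of a knowledge base. -/
def PrefClosure (K : CRel V) : CRel V := {A | Entails K A}

/-- A model is well-founded iff it has no infinite descending chain of states. -/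
def PrefModel.NoInfDesc (W : PrefModel V) : Prop :=
  ¬ ∃ f : ℕ → W.S, ∀ n, W.lt (f (n + 1)) (f n)

/-- A ranked model: the strict order is given by a ranking function into a
totally ordered set. -/
def PrefModel.Ranked (W : PrefModel V) : Prop :=
  ∃ (Ω : Type) (_ : LinearOrder Ω) (r : W.S → Ω), ∀ s t, W.lt s t ↔ r s < r t

/-- α is exceptional for K iff K preferentially entails true |~ ¬α. -/
def Exceptional (K : CRel V) (a : Fm V) : Prop := Entails K (Fm.tru, a.neg)

/-- The set of assertions of K whose antecedent is exceptional for K. -/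
def ESet (K : CRel V) : CRel V := {p ∈ K | Exceptional K p.1}

/-- The exceptionality hierarchy: C₀ = K, C_{τ+1} = E(C_τ), intersections at limits. -/
noncomputable def Cseq (K : CRel V) : Ordinal.{0} → CRel V := fun τ =>
  Ordinal.limitRecOn τ K (fun _ C => ESet C)
    (fun o _ ih => ⋂ ρ : Set.Iio o, ih ρ.1 ρ.2)

/-- α has a rank for K iff it is not exceptional for some C_τ. -/
def HasRank (K : CRel V) (a : Fm V) : Prop := ∃ τ : Ordinal.{0}, ¬ Exceptional (Cseq K τ) a

/-- The rank of α for K: the least τ such that α is not exceptional for C_τ. -/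
noncomputable def rnk (K : CRel V) (a : Fm V) : Ordinal.{0} :=
  sInf {τ : Ordinal.{0} | ¬ Exceptional (Cseq K τ) a}

/-- K is admissible iff every formula with no rank is inconsistent for K. -/
def Admissible (K : CRel V) : Prop :=
  ∀ a : Fm V, ¬ HasRank K a → Entails K (a, Fm.fls)

/-- `α < β in K`: the assertion α∨β |~ ¬β belongs to K. -/
def ltIn (K : CRel V) (a b : Fm V) : Prop := (a.disj b, b.neg) ∈ K

/-- K₀ is preferable to K₁. -/
def Pref (K0 K1 : CRel V) : Prop :=
  (∃ a b, (a, b) ∈ K1 \ K0 ∧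
    ∀ c, ltIn K0 c a → ∀ d, (c, d) ∈ K0 → (c, d) ∈ K1) ∧
  (∀ c d, (c, d) ∈ K0 \ K1 → ∃ r e, (r, e) ∈ K1 \ K0 ∧ ltIn K1 r c)

/-- C is the rational closure of K: a rational extension of K preferable to
every other rational extension of K. -/
def IsRationalClosure (K C : CRel V) : Prop :=
  IsRational C ∧ K ⊆ C ∧ ∀ C', IsRational C' → K ⊆ C' → C' ≠ C → Pref C C'

/-- An assertion α |~ β is supported by K^p iff there is γ with α ⊨ γ and
γ |~ β ∈ K^p. -/
def Supported (K : CRel V) (A : Fm V × Fm V) : Prop :=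
  ∃ c : Fm V, Valid (A.1.impl c) ∧ (c, A.2) ∈ PrefClosure K

/-- Classical entailment from the material counterpart of a knowledge base. -/
def MatEntails (K : CRel V) (a : Fm V) : Prop :=
  ∀ w : V → Bool, (∀ p ∈ K, (p.1.impl p.2).eval w = true) → a.eval w = true

section Rules

variable {K : CRel V}

theorem IsPreferential.weaken (hK : IsPreferential K) {a b c : Fm V} (h : (a, b) ∈ K)
    (hbc : ∀ w, b.eval w = true → c.eval w = true) : (a, c) ∈ K :=
  hK.2.2.1 b c a (fun w => by
    have := hbc w
    cases hb : b.eval w <;> simp_all [Fm.eval]) h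

theorem IsPreferential.congr_left (hK : IsPreferential K) {a b c : Fm V} (h : (a, c) ∈ K)
    (hab : ∀ w, a.eval w = b.eval w) : (b, c) ∈ K :=
  hK.2.1 a b c (fun w => by simp [Fm.eval, hab w]) h

theorem IsPreferential.of_entails (hK : IsPreferential K) {a b : Fm V}
    (h : ∀ w, a.eval w = true → b.eval w = true) : (a, b) ∈ K :=
  hK.weaken (hK.1 a) h

theorem IsPreferential.and (hK : IsPreferential K) {a b c : Fm V}
    (hb : (a, b) ∈ K) (hc : (a, c) ∈ K) : (a, b.conj c) ∈ K :=
  hK.2.2.2.1 a b c hb hc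

/-- Weakening the antecedent turns the consequent into a material implication. -/
theorem IsPreferential.lift (hK : IsPreferential K) {a b c : Fm V} (h : (a, b) ∈ K)
    (hac : ∀ w, a.eval w = true → c.eval w = true) : (c, a.impl b) ∈ K := by
  have h₁ : (a, a.impl b) ∈ K := hK.weaken h (fun w hw => by simp [Fm.eval, hw])
  have h₂ : (c.conj a.neg, a.impl b) ∈ K := hK.of_entails (fun w hw => by
    simp [Fm.eval] at hw ⊢; exact Or.inl hw.2)
  refine hK.congr_left (hK.2.2.2.2.1 _ _ _ h₁ h₂) (fun w => ?_)
  have := hac w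
  cases ha : a.eval w <;> simp_all [Fm.eval]

/-- Cautious monotonicity for an antecedent strengthened to a stronger formula. -/
theorem IsPreferential.restrict (hK : IsPreferential K) {a b c : Fm V}
    (hb : (a, b) ∈ K) (hc : (a, c) ∈ K) (hba : ∀ w, b.eval w = true → a.eval w = true) :
    (b, c) ∈ K := by
  refine hK.congr_left (hK.2.2.2.2.2 a b c hb hc) (fun w => ?_)
  have := hba w
  cases h : b.eval w <;> simp_all [Fm.eval]

theorem ltIn.trans (hK : IsPreferential K) {x y z : Fm V} (hxy : ltIn K x y)
    (hyz : ltIn K y z) : ltIn K x z := by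
  have h₁ := hK.lift (c := (x.disj y).disj z) hxy (fun w hw => by simp_all [Fm.eval])
  have h₂ := hK.lift (c := (x.disj y).disj z) hyz (fun w hw => by
    simp [Fm.eval] at hw ⊢; tauto)
  have h := hK.and (hK.1 ((x.disj y).disj z)) (hK.and h₁ h₂)
  refine hK.restrict (a := (x.disj y).disj z) (hK.weaken h fun w => ?_)
    (hK.weaken h fun w => ?_) (fun w => ?_) <;>
  cases hx : x.eval w <;> cases hy : y.eval w <;> cases hz : z.eval w <;>
    simp [Fm.eval, hx, hy, hz]

theorem ltIn.cotrans (hK : IsRational K) {x z : Fm V} (h : ltIn K x z) (y : Fm V) :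
    ltIn K x y ∨ ltIn K y z := by
  have h₁ := hK.1.and (hK.1.1 ((x.disj y).disj z))
    (hK.1.lift (c := (x.disj y).disj z) h (fun w hw => by
      simp [Fm.eval] at hw ⊢; tauto))
  have h₂ : ((x.disj y).disj z, z.neg) ∈ K := hK.1.weaken h₁ (fun w => by
    cases hx : x.eval w <;> cases hz : z.eval w <;> simp [Fm.eval, hx, hz])
  by_cases hn : ((x.disj y).disj z, (y.disj z).neg) ∈ K
  · left
    refine hK.1.restrict (hK.1.weaken (hK.1.and (hK.1.1 _) h₂) fun w => ?_)
      (hK.1.weaken hn fun w => ?_) (fun w => ?_) <;>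
    cases hx : x.eval w <;> cases hy : y.eval w <;> cases hz : z.eval w <;>
      simp [Fm.eval, hx, hy, hz]
  · right
    have h₃ : (((x.disj y).disj z).conj (y.disj z), z.neg) ∈ K := by
      by_contra hc
      exact hK.2 _ _ _ hc hn h₂
    refine hK.1.congr_left h₃ (fun w => ?_)
    cases hx : x.eval w <;> cases hy : y.eval w <;> cases hz : z.eval w <;>
      simp [Fm.eval, hx, hy, hz]

theorem ltIn.trans_not (hK : IsRational K) {x y z : Fm V} (hxy : ltIn K x y)
    (hzy : ¬ ltIn K z y) : ltIn K x z :=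
  (hxy.cotrans hK z).resolve_right hzy

theorem ltIn.disj_comm (hK : IsPreferential K) {x y : Fm V} (h : ltIn K x y) :
    (y.disj x, y.neg) ∈ K :=
  hK.congr_left h (fun w => by simp [Fm.eval, Bool.or_comm])

theorem ltIn.of_disj_comm (hK : IsPreferential K) {x y : Fm V} (h : (y.disj x, y.neg) ∈ K) :
    ltIn K x y :=
  hK.congr_left h (fun w => by simp [Fm.eval, Bool.or_comm])

theorem ltIn.disj_left (hK : IsPreferential K) {x z : Fm V} (h : ltIn K x z) (y : Fm V) :
    ltIn K (x.disj y) z := by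
  refine hK.weaken (hK.lift h fun w hw => ?_) (fun w => ?_) <;>
  cases hx : x.eval w <;> cases hz : z.eval w <;> simp_all [Fm.eval]

theorem ltIn.disj_right (hK : IsPreferential K) {x z : Fm V} (h : ltIn K x z) (y : Fm V) :
    ltIn K (y.disj x) z :=
  hK.congr_left (h.disj_left hK y) (fun w => by simp [Fm.eval, Bool.or_comm])

theorem ltIn.left_of_disj (hK : IsPreferential K) {x y z : Fm V}
    (h : ltIn K z (x.disj y)) : ltIn K z x := by
  refine hK.restrict (hK.weaken (hK.and (hK.1 _) h) fun w => ?_)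
    (hK.weaken h fun w => ?_) (fun w => ?_) <;>
  cases hx : x.eval w <;> cases hy : y.eval w <;> cases hz : z.eval w <;>
    simp [Fm.eval, hx, hy, hz]

theorem ltIn.right_of_disj (hK : IsPreferential K) {x y z : Fm V}
    (h : ltIn K z (x.disj y)) : ltIn K z y := by
  refine ltIn.left_of_disj (y := x) hK (hK.weaken (hK.congr_left h fun w => ?_) fun w => ?_) <;>
  cases hx : x.eval w <;> cases hy : y.eval w <;> simp [Fm.eval, hx, hy]

theorem not_ltIn_self (hK : IsPreferential K) {x y : Fm V} (h : (x, y) ∉ K) :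
    ¬ ltIn K x x := fun hx =>
  h (hK.weaken (hK.and (hK.1 x) (hK.congr_left hx fun w => by simp [Fm.eval]))
    (fun w hw => by simp [Fm.eval] at hw))

end Rules

section Preference

variable {K₀ K₁ K₂ : CRel V}

/-- The consequences in `K₀` of the formulas strictly below `a` in `K₀` all hold in `K₁`. -/
def PreservedBelow (K₀ K₁ : CRel V) (a : Fm V) : Prop :=
  ∀ c, ltIn K₀ c a → ∀ d, (c, d) ∈ K₀ → (c, d) ∈ K₁

theorem PreservedBelow.ltIn_map (h₀ : IsPreferential K₀) {a x c : Fm V}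
    (hp : PreservedBelow K₀ K₁ a) (hca : ltIn K₀ c a) (hcx : ltIn K₀ c x) : ltIn K₁ c x :=
  hp _ (hca.disj_left h₀ x) _ hcx

theorem PreservedBelow.trans (h₀ : IsRational K₀) {a a' x : Fm V}
    (hp : PreservedBelow K₀ K₁ a) (hp' : PreservedBelow K₁ K₂ a')
    (hax : ¬ ltIn K₀ a x) (hxa' : ∀ c, ltIn K₁ c x → ltIn K₁ c a') :
    PreservedBelow K₀ K₂ x := fun c hc d hcd =>
  have hca := hc.trans_not h₀ hax
  hp' c (hxa' c (hp.ltIn_map h₀.1 hca hc)) d (hp c hca d hcd)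

theorem Pref.irrefl (K : CRel V) : ¬ Pref K K := fun ⟨⟨_, _, h, _⟩, _⟩ => h.2 h.1

theorem Pref.trans_exists_preservedBelow (h₀ : IsRational K₀) (h₁ : IsRational K₁)
    (h₀₁ : Pref K₀ K₁) (h₁₂ : Pref K₁ K₂) :
    ∃ a b, (a, b) ∈ K₂ \ K₀ ∧ PreservedBelow K₀ K₂ a := by
  obtain ⟨⟨a, b, hab, hp⟩, h₀₁⟩ := h₀₁
  obtain ⟨⟨a', b', hab', hp'⟩, -⟩ := h₁₂
  have haa := not_ltIn_self h₀.1 hab.2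
  have key : ∀ x y, (x, y) ∈ K₁ \ K₀ → ¬ ltIn K₀ a x → ltIn K₁ x a' →
      ∃ a b, (a, b) ∈ K₂ \ K₀ ∧ PreservedBelow K₀ K₂ a := fun x y hxy hax hxa' =>
    ⟨x, y, ⟨hp' x hxa' y hxy.1, hxy.2⟩,
      PreservedBelow.trans h₀ hp hp' hax fun _ hc => hc.trans h₁.1 hxa'⟩
  by_cases haa' : ltIn K₁ a a'
  · exact key a b hab haa haa'
  by_cases h : ltIn K₀ a a' ∨ (a', b') ∈ K₀
  · obtain ⟨r, e, hre, hra'⟩ : ∃ r e, (r, e) ∈ K₁ \ K₀ ∧ ltIn K₁ r a' := by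
      rcases h with h | h
      · obtain ⟨r, e, hre, hr⟩ := h₀₁ _ _ ⟨h, haa'⟩
        exact ⟨r, e, hre, hr.right_of_disj h₁.1⟩
      · exact h₀₁ _ _ ⟨h, hab'.2⟩
    by_cases har : ltIn K₀ a r
    · exact key (a.disj r) a.neg
        ⟨(hra'.trans_not h₁ haa').disj_comm h₁.1,
          fun hra => haa (har.trans h₀.1 (.of_disj_comm h₀.1 hra))⟩
        (fun har' => haa (har'.left_of_disj h₀.1)) (hra'.disj_right h₁.1 a)
    · exact key r e hre har hra'
  · rw [not_or] at h
    exact ⟨a', b', ⟨hab'.1, h.2⟩, PreservedBelow.trans h₀ hp hp' h.1 fun _ hc => hc⟩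

theorem Pref.trans_exists_ltIn (h₁ : IsRational K₁) (h₂ : IsRational K₂)
    (h₀₁ : Pref K₀ K₁) (h₁₂ : Pref K₁ K₂) {c d : Fm V} (hcd : (c, d) ∈ K₀ \ K₂) :
    ∃ r e, (r, e) ∈ K₂ \ K₀ ∧ ltIn K₂ r c := by
  obtain ⟨-, h₀₁⟩ := h₀₁
  obtain ⟨⟨a, b, hab, hp⟩, h₁₂⟩ := h₁₂
  have haa := not_ltIn_self h₁.1 hab.2
  have key : ∀ x y, (x, y) ∈ K₂ \ K₁ → ¬ ltIn K₁ a x → ltIn K₂ x c →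
      ∃ r e, (r, e) ∈ K₂ \ K₀ ∧ ltIn K₂ r c := by
    intro x y hxy hax hxc
    by_cases hxy₀ : (x, y) ∈ K₀
    · obtain ⟨r, e, hre, hrx⟩ := h₀₁ _ _ ⟨hxy₀, hxy.2⟩
      have hra := hrx.trans_not h₁ hax
      exact ⟨r, e, ⟨hp r hra e hre.1, hre.2⟩,
        (PreservedBelow.ltIn_map h₁.1 hp hra hrx).trans h₂.1 hxc⟩
    · exact ⟨x, y, ⟨hxy.1, hxy₀⟩, hxc⟩
  have of_witness : ∀ s f, (s, f) ∈ K₂ \ K₁ → ltIn K₂ s c →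
      ∃ r e, (r, e) ∈ K₂ \ K₀ ∧ ltIn K₂ r c := by
    intro s f hsf hsc
    by_cases has : ltIn K₁ a s
    · by_cases hac : ltIn K₂ a c
      · exact key a b hab haa hac
      · exact key (a.disj s) a.neg
          ⟨(hsc.trans_not h₂ hac).disj_comm h₂.1,
            fun hsa => haa (has.trans h₁.1 (.of_disj_comm h₁.1 hsa))⟩
          (fun h => haa (h.left_of_disj h₁.1)) (hsc.disj_right h₂.1 a)
    · exact key s f hsf has hsc
  by_cases hcd₁ : (c, d) ∈ K₁
  · obtain ⟨s, f, hsf, hsc⟩ := h₁₂ _ _ ⟨hcd₁, hcd.2⟩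
    exact of_witness s f hsf hsc
  obtain ⟨r, e, hre, hrc⟩ := h₀₁ _ _ ⟨hcd.1, hcd₁⟩
  by_cases hrc₂ : ltIn K₂ r c
  · by_cases hre₂ : (r, e) ∈ K₂
    · exact ⟨r, e, ⟨hre₂, hre.2⟩, hrc₂⟩
    · obtain ⟨s, f, hsf, hsr⟩ := h₁₂ _ _ ⟨hre.1, hre₂⟩
      exact of_witness s f hsf (hsr.trans h₂.1 hrc₂)
  · obtain ⟨s, f, hsf, hs⟩ := h₁₂ _ _ ⟨hrc, hrc₂⟩
    exact of_witness s f hsf (hs.right_of_disj h₂.1)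

theorem Pref.trans (h₀ : IsRational K₀) (h₁ : IsRational K₁) (h₂ : IsRational K₂)
    (h₀₁ : Pref K₀ K₁) (h₁₂ : Pref K₁ K₂) : Pref K₀ K₂ :=
  ⟨h₀₁.trans_exists_preservedBelow h₀ h₁ h₁₂,
    fun _ _ hcd => h₀₁.trans_exists_ltIn h₁ h₂ h₁₂ hcd⟩

theorem Pref.asymm (h₀ : IsRational K₀) (h₁ : IsRational K₁) (h₀₁ : Pref K₀ K₁) :
    ¬ Pref K₁ K₀ := fun h₁₀ =>
  Pref.irrefl K₀ (h₀₁.trans h₀ h₁ h₀ h₁₀)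

theorem IsRationalClosure.eq_or_pref {K C C' : CRel V} (h : IsRationalClosure K C)
    (hC' : IsRational C') (hK : K ⊆ C') : C = C' ∨ Pref C C' :=
  or_iff_not_imp_left.2 fun hne => h.2.2 C' hC' hK (Ne.symm hne)

end Preference

/-- Loop property of rational closure, and cumulativity as the special case. -/
theorem stmt16 (V : Type) :
    (∀ (n : ℕ) (hn : 0 < n) (Ks Cs : Fin n → CRel V),
      (∀ i, IsRationalClosure (Ks i) (Cs i)) →
      (∀ i : Fin n, Ks ⟨(i.1 + 1) % n, Nat.mod_lt _ hn⟩ ⊆ Cs i) →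
      ∀ i j, Cs i = Cs j) ∧
    (∀ X Y CX CY : CRel V, X ⊆ Y → Y ⊆ CX →
      IsRationalClosure X CX → IsRationalClosure Y CY → CX = CY) := by
  constructor
  · intro n hn Ks Cs hC hK
    let f : ℕ → CRel V := fun k => Cs ⟨k % n, Nat.mod_lt _ hn⟩
    have hf : ∀ k, IsRational (f k) := fun k => (hC _).1
    have step : ∀ k, f (k + 1) = f k ∨ Pref (f (k + 1)) (f k) := by
      intro k
      refine (hC _).eq_or_pref (hf k) ?_
      have := hK ⟨k % n, Nat.mod_lt _ hn⟩
      simpa only [Nat.mod_add_mod] using this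
    have mono : ∀ k l, k ≤ l → f l = f k ∨ Pref (f l) (f k) := by
      intro k l hkl
      induction l, hkl using Nat.le_induction with
      | base => exact Or.inl rfl
      | succ l _ ih =>
        rcases step l with h | h
        · rwa [h]
        · rcases ih with h' | h'
          · exact Or.inr (h' ▸ h)
          · exact Or.inr (h.trans (hf _) (hf _) (hf _) h')
    have eq_of_le : ∀ i j, i ≤ j → j < n → f i = f j := by
      intro i j hij hj
      have hper : f (i + n) = f i := by simp [f]
      rcases mono i j hij with h | h
      · exact h.symm
      · have h' := mono j (i + n) (by omega)
        rw [hper] at h'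
        exact h'.resolve_right (h.asymm (hf _) (hf _))
    have hfC : ∀ i : Fin n, f i = Cs i := fun i => by simp [f, Nat.mod_eq_of_lt i.2]
    intro i j
    rw [← hfC i, ← hfC j]
    rcases le_total i.1 j.1 with h | h
    · exact eq_of_le _ _ h j.2
    · exact (eq_of_le _ _ h i.2).symm
  · intro X Y CX CY hXY hYC hX hY
    rcases hX.eq_or_pref hY.1 (hXY.trans hY.2.1) with h | h
    · exact h
    · exact ((hY.eq_or_pref hX.1 hYC).resolve_right (h.asymm hX.1 hY.1)).symm
end

section
/- Let K be a conditional knowledge base, let K̃ be its material counterpart (the set of formulas α → β for each assertion α |~ β in K), and let α be a formula. Then K̃ classically entails α (every world satisfying all formulas of K̃ satisfies α) if and only if K preferentially entails the assertion true |~ α. Consequently, a formula α is exceptional for K if and only if K̃ classically entails ¬α. -/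
variable {V : Type}

/-- A world satisfies the material implication iff it satisfies the classical conditional. -/
theorem Fm.eval_impl_iff (w : V → Bool) (a b : Fm V) :
    (a.impl b).eval w = true ↔ (a.eval w = true → b.eval w = true) := by
  simp only [Fm.eval]
  cases a.eval w <;> simp

/-- The preferential model with a single state, labeled by the world `w`. -/
def PrefModel.single (w : V → Bool) : PrefModel V where
  S := Unit
  l _ := w
  lt _ _ := False
  irrefl _ := id
  trans _ _ _ h _ := h
  smooth _ _ h := Or.inl ⟨h, fun _ _ => id⟩

theorem PrefModel.single_sat_iff (w : V → Bool) (a b : Fm V) :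
    (PrefModel.single w).Sat a b ↔ (a.impl b).eval w = true := by
  rw [Fm.eval_impl_iff]
  exact ⟨fun h ha => h () ⟨ha, fun _ _ => id⟩, fun h _ hs => h hs.1⟩

theorem matEntails_iff_entails_tru (K : CRel V) (a : Fm V) :
    MatEntails K a ↔ Entails K (Fm.tru, a) := by
  constructor
  · intro h W hW s hs
    refine h (W.l s) fun p hp => (Fm.eval_impl_iff _ _ _).2 fun h1 => ?_
    exact hW p hp s ⟨h1, fun t _ => hs.2 t rfl⟩
  · intro h w hw
    have hsat := h (PrefModel.single w) fun p hp =>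
      (PrefModel.single_sat_iff w p.1 p.2).2 (hw p hp)
    exact (Fm.eval_impl_iff _ _ _).1 ((PrefModel.single_sat_iff _ _ _).1 hsat) rfl

/-- The material counterpart of K classically entails α iff K preferentially
entails true |~ α; consequently, α is exceptional for K iff the material
counterpart of K classically entails ¬α. -/
theorem stmt19 (V : Type) (K : CRel V) :
    (∀ a : Fm V, MatEntails K a ↔ Entails K (Fm.tru, a)) ∧
    (∀ a : Fm V, Exceptional K a ↔ MatEntails K a.neg) := by
  exact ⟨matEntails_iff_entails_tru K, fun a => (matEntails_iff_entails_tru K a.neg).symm⟩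
end
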